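/- Let q be a prime power and n, k, l, s positive integers with kls | n and k, l, s pairwise relatively prime. Let γ ∈ F_{q^n}^* be a root of an irreducible polynomial of degree n/(kls) over F_{q^{kls}}, where n/(kls) > 12, and let δ_1, δ_2 ∈ F_{q^l}^*, τ_1, τ_2 ∈ F_{q^k}^*, η_1, η_2 ∈ F_{q^s}^*. Then U = {δ_1 a + δ_2 a^q γ + τ_1 u γ^2 + τ_2 u^q γ^3 + η_1 e γ^5 + η_2 e^q γ^6 : a ∈ F_{q^l}, u ∈ F_{q^k}, e ∈ F_{q^s}} is a Sidon space of F_q-dimension k + l + s. -/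

import Mathlib

open Submodule Pointwise

set_option maxHeartbeats 1000000
set_option synthInstance.maxHeartbeats 400000

/-- An `F`-subspace `V` of a field `K` is a *Sidon space* if for all nonzero
`a, b, c, d ∈ V` with `a * b = c * d` one has `{aF, bF} = {cF, dF}` (as a pair of
one-dimensional `F`-subspaces). -/
def IsSidonSpace {K : Type*} [Field K] (F : Subfield K) (V : Submodule F K) : Prop :=
  ∀ a ∈ V, ∀ b ∈ V, ∀ c ∈ V, ∀ d ∈ V,
    a ≠ 0 → b ≠ 0 → c ≠ 0 → d ≠ 0 → a * b = c * d →
    ({Submodule.span F {a}, Submodule.span F {b}} : Set (Submodule F K)) =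
      {Submodule.span F {c}, Submodule.span F {d}}

section QuadraticForms

variable {K ι : Type*} [Field K] {q : ℕ}

/-- Two factorizations of one quadratic form into linear forms share a factor, up to a scalar. -/
theorem exists_smul_eq_or_of_mul_eq {v w x y : ι → K} (hv : v ≠ 0) (hx : x ≠ 0) (hy : y ≠ 0)
    (hmul : ∀ i j, v i * w j + v j * w i = x i * y j + x j * y i)
    (hdiag : ∀ i, v i * w i = x i * y i) :
    ∃ c : K, c ≠ 0 ∧ (v = c • x ∨ v = c • y) := by
  have hprod (i j) : (v i * x j - v j * x i) * (v i * y j - v j * y i) = 0 := by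
    linear_combination v i * v j * hmul i j - v i ^ 2 * hdiag j - v j ^ 2 * hdiag i
  have hcross (i j k l) : (v i * x j - v j * x i) * (v k * y l - v l * y k) +
      (v k * x l - v l * x k) * (v i * y j - v j * y i) = 0 := by
    linear_combination v i * v l * hmul j k + v j * v k * hmul i l - v i * v k * hmul j l
      - v j * v l * hmul i k
  have hminors : (∀ i j, v i * x j - v j * x i = 0) ∨ ∀ i j, v i * y j - v j * y i = 0 := by
    by_contra! h
    obtain ⟨⟨i, j, hij⟩, k, l, hkl⟩ := h
    have h₁ := (mul_eq_zero.mp (hprod i j)).resolve_left hij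
    have h₂ := hcross i j k l
    rw [h₁, mul_zero, add_zero] at h₂
    exact mul_ne_zero hij hkl h₂
  have hscalar {z : ι → K} (hz : z ≠ 0) (h : ∀ i j, v i * z j - v j * z i = 0) :
      ∃ c : K, c ≠ 0 ∧ v = c • z := by
    obtain ⟨j, hj⟩ := Function.ne_iff.mp hz
    have hj : z j ≠ 0 := hj
    have hvz : v = (v j / z j) • z := by
      funext i
      simp only [Pi.smul_apply, smul_eq_mul]
      field_simp
      linear_combination h i j
    refine ⟨v j / z j, fun hc => hv ?_, hvz⟩
    rw [hvz, hc, zero_smul]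
  rcases hminors with h | h
  · exact (hscalar hx h).imp fun c hc => ⟨hc.1, .inl hc.2⟩
  · exact (hscalar hy h).imp fun c hc => ⟨hc.1, .inr hc.2⟩

theorem exists_pow_eq_self_of_mul_eq {a b c d : K} (ha : a ≠ 0) (hc : c ≠ 0) (hd : d ≠ 0)
    (h : a * b = c * d) (hpow : a * b ^ q + a ^ q * b = c * d ^ q + c ^ q * d) :
    ∃ r : K, r ≠ 0 ∧ r ^ q = r ∧ (a = r * c ∨ a = r * d) := by
  have hq : a ^ q * b ^ q = c ^ q * d ^ q := by rw [← mul_pow, h, mul_pow]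
  have hprod : (a ^ q * c - c ^ q * a) * (a ^ q * d - d ^ q * a) = 0 := by
    linear_combination a ^ q * a * hpow - (a ^ q) ^ 2 * h - a ^ 2 * hq
  have hratio {x : K} (hx : x ≠ 0) (h : a ^ q * x - x ^ q * a = 0) :
      a / x ≠ 0 ∧ (a / x) ^ q = a / x ∧ a = a / x * x := by
    refine ⟨div_ne_zero ha hx, ?_, (div_mul_cancel₀ a hx).symm⟩
    rw [div_pow, div_eq_div_iff (pow_ne_zero q hx) hx]
    linear_combination h
  rcases mul_eq_zero.mp hprod with h | h
  · exact ⟨a / c, (hratio hc h).1, (hratio hc h).2.1, .inl (hratio hc h).2.2⟩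
  · exact ⟨a / d, (hratio hd h).1, (hratio hd h).2.1, .inr (hratio hd h).2.2⟩

theorem exists_pow_eq_self_of_eq_smul {L : ι → Subfield K}
    (hL : ∀ i j, i ≠ j → ∀ x ∈ L i, x ∈ L j → x ^ q = x) {v w x y : ι → K}
    (hvL : ∀ i, v i ∈ L i) (hwL : ∀ i, w i ∈ L i) (hxL : ∀ i, x i ∈ L i) (hyL : ∀ i, y i ∈ L i)
    (hx : x ≠ 0) (hy : y ≠ 0)
    (hmul : ∀ i j, v i * w j + v j * w i = x i * y j + x j * y i)
    (hdiag : ∀ i, v i * w i = x i * y i)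
    (hpow : ∀ i, v i * w i ^ q + v i ^ q * w i = x i * y i ^ q + x i ^ q * y i)
    {c : K} (hc : c ≠ 0) (hvx : v = c • x) :
    ∃ r : K, r ≠ 0 ∧ r ^ q = r ∧ (v = r • x ∨ v = r • y) := by
  by_cases hcq : c ^ q = c
  · exact ⟨c, hc, hcq, .inl hvx⟩
  have hvx' (i) : v i = c * x i := congrFun hvx i
  obtain ⟨i, hi⟩ := Function.ne_iff.mp hx
  have hi : x i ≠ 0 := hi
  have hyi : y i = c * w i := mul_left_cancel₀ hi (by rw [← hdiag, hvx']; ring)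
  have hyw (j) : y j = c * w j := mul_left_cancel₀ hi (by
    linear_combination -hmul i j + w j * hvx' i + w i * hvx' j - x j * hyi)
  have hcL {j : ι} {s t : K} (hs : s ∈ L j) (ht : t ∈ L j) (h : s = c * t) (ht0 : t ≠ 0) :
      c ∈ L j := by
    rw [eq_div_of_mul_eq ht0 h.symm]
    exact div_mem hs ht
  have hci : c ∈ L i := hcL (hvL i) (hxL i) (hvx' i) hi
  have hxj (j) (hj : j ≠ i) : x j = 0 := by
    by_contra h
    exact hcq (hL j i hj c (hcL (hvL j) (hxL j) (hvx' j) h) hci)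
  have hwj (j) (hj : j ≠ i) : w j = 0 := by
    by_contra h
    exact hcq (hL j i hj c (hcL (hyL j) (hwL j) (hyw j) h) hci)
  have hyi0 : y i ≠ 0 := by
    intro h
    apply hy
    funext j
    by_cases hj : j = i
    · rw [hj, h]; rfl
    · rw [hyw, hwj j hj, mul_zero]; rfl
  obtain ⟨r, hr, hrq, h⟩ := exists_pow_eq_self_of_mul_eq (by rw [hvx']; exact mul_ne_zero hc hi)
    hi hyi0 (hdiag i) (hpow i)
  refine ⟨r, hr, hrq, h.imp (fun h => ?_) fun h => ?_⟩ <;> funext j <;> by_cases hj : j = i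
  · rw [hj, h]; rfl
  · simp [hvx', hxj j hj]
  · rw [hj, h]; rfl
  · simp [hvx', hxj j hj, hyw, hwj j hj]

/-- If `v`, `w`, `x`, `y` have coordinates in fields meeting pairwise in the `q`-Frobenius fixed
field, and the products of linear forms `v · w` and `x · y` agree, as do the coordinatewise
symmetrizations of `v * w ^ q` and `x * y ^ q`, then `v` is a Frobenius-fixed multiple of `x`
or of `y`. -/
theorem exists_pow_eq_self_smul_of_mul_eq {L : ι → Subfield K}
    (hL : ∀ i j, i ≠ j → ∀ x ∈ L i, x ∈ L j → x ^ q = x) {v w x y : ι → K}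
    (hvL : ∀ i, v i ∈ L i) (hwL : ∀ i, w i ∈ L i) (hxL : ∀ i, x i ∈ L i) (hyL : ∀ i, y i ∈ L i)
    (hv : v ≠ 0) (hx : x ≠ 0) (hy : y ≠ 0)
    (hmul : ∀ i j, v i * w j + v j * w i = x i * y j + x j * y i)
    (hdiag : ∀ i, v i * w i = x i * y i)
    (hpow : ∀ i, v i * w i ^ q + v i ^ q * w i = x i * y i ^ q + x i ^ q * y i) :
    ∃ r : K, r ≠ 0 ∧ r ^ q = r ∧ (v = r • x ∨ v = r • y) := by
  obtain ⟨c, hc, h | h⟩ := exists_smul_eq_or_of_mul_eq hv hx hy hmul hdiag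
  · exact exists_pow_eq_self_of_eq_smul hL hvL hwL hxL hyL hx hy hmul hdiag hpow hc h
  · obtain ⟨r, hr, hrq, h⟩ := exists_pow_eq_self_of_eq_smul hL hvL hwL hyL hxL hy hx
      (fun i j => by rw [hmul]; ring) (fun i => by rw [hdiag]; ring)
      (fun i => by rw [hpow]; ring) hc h
    exact ⟨r, hr, hrq, h.symm⟩

end QuadraticForms

section FiniteFields

variable {K : Type*} [Field K]

theorem eq_of_sum_mul_pow_eq {L : Subfield K} {γ : K} {N : ℕ} (hN : N ≤ (minpoly L γ).natDegree)
    {c d : Fin N → K} (hc : ∀ i, c i ∈ L) (hd : ∀ i, d i ∈ L)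
    (h : ∑ i, c i * γ ^ (i : ℕ) = ∑ i, d i * γ ^ (i : ℕ)) : c = d := by
  have hli := (linearIndependent_pow (K := L) γ).comp _ (Fin.castLE_injective hN)
  have h0 := Fintype.linearIndependent_iff.mp hli (fun i => ⟨c i, hc i⟩ - ⟨d i, hd i⟩) (by
    simpa [Subfield.smul_def, sub_mul, sub_eq_zero] using h)
  funext i
  simpa [sub_eq_zero] using h0 i

/-- The `q`-power map of a field containing `q` elements forming a subfield is additive. -/
theorem add_pow_natCard_subfield (F : Subfield K) [Finite F] (x y : K) :
    (x + y) ^ Nat.card F = x ^ Nat.card F + y ^ Nat.card F := by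
  have := Fintype.ofFinite F
  obtain ⟨p, hp⟩ := CharP.exists F
  obtain ⟨m, hp', hm⟩ := FiniteField.card F p
  have := Fact.mk hp'
  have : CharP K p := charP_of_injective_algebraMap (algebraMap F K).injective p
  rw [Nat.card_eq_fintype_card, hm, add_pow_char_pow]

theorem pow_natCard_eq_self {F : Subfield K} [Finite F] {x : K} (hx : x ∈ F) :
    x ^ Nat.card F = x := by
  have := Fintype.ofFinite F
  rw [Nat.card_eq_fintype_card]
  exact congrArg Subtype.val (FiniteField.pow_card (⟨x, hx⟩ : F))

theorem pow_eq_self_of_coprime {q m n : ℕ} (hmn : m.Coprime n) {x : K}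
    (hm : x ^ q ^ m = x) (hn : x ^ q ^ n = x) : x ^ q = x := by
  have hper {k : ℕ} (hk : x ^ q ^ k = x) : Function.IsPeriodicPt (fun y : K => y ^ q) k x := by
    rw [Function.IsPeriodicPt, pow_iterate]
    exact hk
  have := (hper hm).gcd (hper hn)
  rw [hmn] at this
  exact this

theorem mem_of_pow_natCard_eq_self {F : Subfield K} [Finite F] {x : K}
    (hx : x ^ Nat.card F = x) : x ∈ F := by
  have := Fintype.ofFinite F
  have hne := FiniteField.X_pow_card_sub_X_ne_zero F (Fintype.one_lt_card (α := F))
  have hsplits := (FiniteField.isSplittingField_sub F F).splits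
  rw [Algebra.algebraMap_self, Polynomial.map_id] at hsplits
  obtain ⟨y, rfl⟩ := hsplits.mem_range_of_isRoot hne (i := F.subtype) (x := x)
    (by simp [← Nat.card_eq_fintype_card, hx])
  exact y.2


/-- The coefficients of a product of polynomials supported in degrees `0, 1, 2, 3, 5, 6`. -/
def sexticMulCoeffs {R : Type*} [Semiring R] (x y : Fin 6 → R) : Fin 13 → R :=
  ![x 0 * y 0, x 0 * y 1 + x 1 * y 0, x 1 * y 1 + x 0 * y 2 + x 2 * y 0,
    x 0 * y 3 + x 3 * y 0 + x 1 * y 2 + x 2 * y 1, x 1 * y 3 + x 3 * y 1 + x 2 * y 2,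
    x 2 * y 3 + x 3 * y 2 + x 0 * y 4 + x 4 * y 0,
    x 3 * y 3 + x 0 * y 5 + x 5 * y 0 + x 1 * y 4 + x 4 * y 1,
    x 1 * y 5 + x 5 * y 1 + x 2 * y 4 + x 4 * y 2,
    x 2 * y 5 + x 5 * y 2 + x 3 * y 4 + x 4 * y 3, x 3 * y 5 + x 5 * y 3, x 4 * y 4,
    x 4 * y 5 + x 5 * y 4, x 5 * y 5]

theorem sexticMulCoeffs_mem {L : Subfield K} {x y : Fin 6 → K} (hx : ∀ i, x i ∈ L)
    (hy : ∀ i, y i ∈ L) (i : Fin 13) : sexticMulCoeffs x y i ∈ L := by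
  fin_cases i <;> simp [sexticMulCoeffs] <;> apply_rules [add_mem, mul_mem]

theorem coeffs_eq_of_sextic_mul_eq {L : Subfield K} {γ : K} (hγ : 12 < (minpoly L γ).natDegree)
    {x y z w : Fin 6 → K} (hx : ∀ i, x i ∈ L) (hy : ∀ i, y i ∈ L) (hz : ∀ i, z i ∈ L)
    (hw : ∀ i, w i ∈ L)
    (h : (x 0 + x 1 * γ + x 2 * γ ^ 2 + x 3 * γ ^ 3 + x 4 * γ ^ 5 + x 5 * γ ^ 6) *
        (y 0 + y 1 * γ + y 2 * γ ^ 2 + y 3 * γ ^ 3 + y 4 * γ ^ 5 + y 5 * γ ^ 6) =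
      (z 0 + z 1 * γ + z 2 * γ ^ 2 + z 3 * γ ^ 3 + z 4 * γ ^ 5 + z 5 * γ ^ 6) *
        (w 0 + w 1 * γ + w 2 * γ ^ 2 + w 3 * γ ^ 3 + w 4 * γ ^ 5 + w 5 * γ ^ 6)) :
    sexticMulCoeffs x y = sexticMulCoeffs z w := by
  refine eq_of_sum_mul_pow_eq hγ (sexticMulCoeffs_mem hx hy) (sexticMulCoeffs_mem hz hw) ?_
  simp only [sexticMulCoeffs, Fin.sum_univ_succ]
  simp
  linear_combination h

end FiniteFields

section Sidon

variable {K : Type*} [Field K]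

/-- The coefficients in the powers `γ ^ i`, `i = 0, 1, 2, 3, 5, 6`, of an element of the space. -/
def twistedCoeffs (q : ℕ) (α β v : Fin 3 → K) : Fin 6 → K :=
  ![α 0 * v 0, β 0 * v 0 ^ q, α 1 * v 1, β 1 * v 1 ^ q, α 2 * v 2, β 2 * v 2 ^ q]

theorem symmetrizations_eq_of_coeffs_eq {q : ℕ} (hq : q ≠ 0)
    (hadd : ∀ x y : K, (x + y) ^ q = x ^ q + y ^ q) {α β : Fin 3 → K} (hα : ∀ i, α i ≠ 0)
    (hβ : ∀ i, β i ≠ 0) {v w x y : Fin 3 → K}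
    (h : sexticMulCoeffs (twistedCoeffs q α β v) (twistedCoeffs q α β w) =
      sexticMulCoeffs (twistedCoeffs q α β x) (twistedCoeffs q α β y)) :
    (∀ i j, v i * w j + v j * w i = x i * y j + x j * y i) ∧ (∀ i, v i * w i = x i * y i) ∧
      ∀ i, v i * w i ^ q + v i ^ q * w i = x i * y i ^ q + x i ^ q * y i := by
  have hinj {s t : K} (h : s ^ q = t ^ q) : s = t := by
    have := hadd (s - t) t
    rw [sub_add_cancel, h, right_eq_add] at this
    exact sub_eq_zero.mp (pow_eq_zero_iff hq |>.mp this)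
  have hprod {a b c d : K} (h : a * b = c * d) : a ^ q * b ^ q = c ^ q * d ^ q := by
    rw [← mul_pow, h, mul_pow]
  have hsum {a b c d a' b' c' d' : K} (h : a * b + c * d = a' * b' + c' * d') :
      a ^ q * b ^ q + c ^ q * d ^ q = a' ^ q * b' ^ q + c' ^ q * d' ^ q := by
    rw [← mul_pow, ← mul_pow, ← hadd, h, hadd, mul_pow, mul_pow]
  have h0 := congrFun h 0
  have h1 := congrFun h 1
  have h2 := congrFun h 2
  have h4 := congrFun h 4
  have h5 := congrFun h 5
  have h7 := congrFun h 7
  have h9 := congrFun h 9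
  have h10 := congrFun h 10
  have h11 := congrFun h 11
  simp [sexticMulCoeffs, twistedCoeffs] at h0 h1 h2 h4 h5 h7 h9 h10 h11
  have cancel {r s t : K} (hr : r ≠ 0) (h : r * s = r * t) : s = t := mul_left_cancel₀ hr h
  have d0 : v 0 * w 0 = x 0 * y 0 :=
    cancel (mul_ne_zero (hα 0) (hα 0)) (by linear_combination h0)
  have p0 : v 0 * w 0 ^ q + v 0 ^ q * w 0 = x 0 * y 0 ^ q + x 0 ^ q * y 0 :=
    cancel (mul_ne_zero (hα 0) (hβ 0)) (by linear_combination h1)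
  have m01 : v 0 * w 1 + v 1 * w 0 = x 0 * y 1 + x 1 * y 0 :=
    cancel (mul_ne_zero (hα 0) (hα 1)) (by linear_combination h2 - β 0 ^ 2 * hprod d0)
  have d1 : v 1 * w 1 = x 1 * y 1 :=
    cancel (mul_ne_zero (hα 1) (hα 1)) (by linear_combination h4 - β 0 * β 1 * hsum m01)
  have d2 : v 2 * w 2 = x 2 * y 2 :=
    cancel (mul_ne_zero (hα 2) (hα 2)) (by linear_combination h10)
  have p2 : v 2 * w 2 ^ q + v 2 ^ q * w 2 = x 2 * y 2 ^ q + x 2 ^ q * y 2 :=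
    cancel (mul_ne_zero (hα 2) (hβ 2)) (by linear_combination h11)
  have m12 : v 1 * w 2 + v 2 * w 1 = x 1 * y 2 + x 2 * y 1 := by
    apply hinj
    simp only [hadd, mul_pow]
    exact cancel (mul_ne_zero (hβ 1) (hβ 2)) (by linear_combination h9)
  have m02 : v 0 * w 2 + v 2 * w 0 = x 0 * y 2 + x 2 * y 0 := by
    apply hinj
    simp only [hadd, mul_pow]
    exact cancel (mul_ne_zero (hβ 0) (hβ 2)) (by linear_combination h7 - α 1 * α 2 * m12)
  have p1 : v 1 * w 1 ^ q + v 1 ^ q * w 1 = x 1 * y 1 ^ q + x 1 ^ q * y 1 :=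
    cancel (mul_ne_zero (hα 1) (hβ 1)) (by linear_combination h5 - α 0 * α 2 * m02)
  refine ⟨?_, ?_, ?_⟩
  · intro i j
    fin_cases i <;> fin_cases j <;> simp only [Fin.zero_eta, Fin.mk_one, Fin.reduceFinMk]
    exacts [by rw [d0], m01, m02, by linear_combination m01, by rw [d1], m12,
      by linear_combination m02, by linear_combination m12, by rw [d2]]
  · intro i
    fin_cases i
    exacts [d0, d1, d2]
  · intro i
    fin_cases i
    exacts [p0, p1, p2]

/-- The `F`-linear parametrization of the space by the product of the fields `L i`. -/
def twistedMap (F : Subfield K) {q : ℕ} (hadd : ∀ x y : K, (x + y) ^ q = x ^ q + y ^ q)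
    (hF : ∀ c ∈ F, c ^ q = c) {L : Fin 3 → Subfield K} (hL : ∀ i, F ≤ L i) (α β : Fin 3 → K)
    (γ : K) : (∀ i, Subfield.extendScalars (hL i)) →ₗ[F] K where
  toFun v := α 0 * v 0 + β 0 * (v 0 : K) ^ q * γ + α 1 * v 1 * γ ^ 2 +
    β 1 * (v 1 : K) ^ q * γ ^ 3 + α 2 * v 2 * γ ^ 5 + β 2 * (v 2 : K) ^ q * γ ^ 6
  map_add' v w := by
    simp only [Pi.add_apply, IntermediateField.coe_add, hadd]
    ring
  map_smul' c v := by
    simp only [Pi.smul_apply, IntermediateField.coe_smul, Subfield.smul_def, smul_eq_mul, mul_pow,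
      hF c c.2, RingHom.id_apply]
    ring

section TwistedMap

variable {F : Subfield K} {q : ℕ} (hadd : ∀ x y : K, (x + y) ^ q = x ^ q + y ^ q)
  (hF : ∀ c ∈ F, c ^ q = c) {L : Fin 3 → Subfield K} (hL : ∀ i, F ≤ L i) {α β : Fin 3 → K} {γ : K}

theorem symmetrizations_eq_of_twistedMap_mul_eq (hq : q ≠ 0) (hα : ∀ i, α i ≠ 0)
    (hβ : ∀ i, β i ≠ 0) {M : Subfield K} (hM : ∀ i, L i ≤ M) (hαM : ∀ i, α i ∈ M)
    (hβM : ∀ i, β i ∈ M) (hγ : 12 < (minpoly M γ).natDegree)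
    {v w x y : ∀ i, Subfield.extendScalars (hL i)}
    (h : twistedMap F hadd hF hL α β γ v * twistedMap F hadd hF hL α β γ w =
      twistedMap F hadd hF hL α β γ x * twistedMap F hadd hF hL α β γ y) :
    (∀ i j, (v i * w j + v j * w i : K) = x i * y j + x j * y i) ∧
      (∀ i, (v i * w i : K) = x i * y i) ∧
      ∀ i, (v i * w i ^ q + v i ^ q * w i : K) = x i * y i ^ q + x i ^ q * y i := by
  have hmem (v : ∀ i, Subfield.extendScalars (hL i)) (i : Fin 6) :
      twistedCoeffs q α β (fun i => v i) i ∈ M := by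
    have hv (i) : (v i : K) ∈ M := hM i (v i).2
    fin_cases i
    exacts [mul_mem (hαM 0) (hv 0), mul_mem (hβM 0) (pow_mem (hv 0) q), mul_mem (hαM 1) (hv 1),
      mul_mem (hβM 1) (pow_mem (hv 1) q), mul_mem (hαM 2) (hv 2), mul_mem (hβM 2) (pow_mem (hv 2) q)]
  exact symmetrizations_eq_of_coeffs_eq hq hadd hα hβ
    (coeffs_eq_of_sextic_mul_eq hγ (hmem v) (hmem w) (hmem x) (hmem y) h)

theorem twistedMap_injective (hq : q ≠ 0) (hα : ∀ i, α i ≠ 0)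
    (hβ : ∀ i, β i ≠ 0) {M : Subfield K} (hM : ∀ i, L i ≤ M) (hαM : ∀ i, α i ∈ M)
    (hβM : ∀ i, β i ∈ M) (hγ : 12 < (minpoly M γ).natDegree) :
    Function.Injective (twistedMap F hadd hF hL α β γ) := by
  rw [injective_iff_map_eq_zero]
  intro v hv
  have h := (symmetrizations_eq_of_twistedMap_mul_eq hadd hF hL hq hα hβ hM hαM hβM hγ
    (v := v) (w := v) (x := 0) (y := 0) (by rw [hv, map_zero])).2.1
  funext i
  simpa using h i

theorem isSidonSpace_range_twistedMap (hq : q ≠ 0) (hFq : ∀ c : K, c ^ q = c → c ∈ F)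
    (hLL : ∀ i j, i ≠ j → ∀ x ∈ L i, x ∈ L j → x ^ q = x) (hα : ∀ i, α i ≠ 0)
    (hβ : ∀ i, β i ≠ 0) {M : Subfield K} (hM : ∀ i, L i ≤ M) (hαM : ∀ i, α i ∈ M)
    (hβM : ∀ i, β i ∈ M) (hγ : 12 < (minpoly M γ).natDegree) :
    IsSidonSpace F (LinearMap.range (twistedMap F hadd hF hL α β γ)) := by
  have hspan {a b c d : K} (hc : c ≠ 0) (h : a * b = c * d) {r : F} (hr : r ≠ 0)
      (hac : a = r • c) : span F {a} = span F {c} ∧ span F {b} = span F {d} := by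
    have hd : d = r • b := mul_left_cancel₀ hc (by
      rw [← h, hac, Subfield.smul_def, Subfield.smul_def, smul_eq_mul, smul_eq_mul]
      ring)
    rw [hac, hd]
    exact ⟨span_singleton_smul_eq hr.isUnit c, (span_singleton_smul_eq hr.isUnit b).symm⟩
  rintro _ ⟨v, rfl⟩ _ ⟨w, rfl⟩ _ ⟨x, rfl⟩ _ ⟨y, rfl⟩ hv - hx hy h
  have hne {z : ∀ i, Subfield.extendScalars (hL i)}
      (hz : twistedMap F hadd hF hL α β γ z ≠ 0) : (fun i => (z i : K)) ≠ 0 := by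
    contrapose! hz
    have : z = 0 := funext fun i => Subtype.ext (congrFun hz i)
    rw [this, map_zero]
  obtain ⟨hmul, hdiag, hpow⟩ :=
    symmetrizations_eq_of_twistedMap_mul_eq hadd hF hL hq hα hβ hM hαM hβM hγ h
  have hsmul {r : K} (hr : r ^ q = r) {z : ∀ i, Subfield.extendScalars (hL i)}
      (hvz : (fun i => (v i : K)) = r • fun i => (z i : K)) :
      twistedMap F hadd hF hL α β γ v =
        (⟨r, hFq r hr⟩ : F) • twistedMap F hadd hF hL α β γ z := by
    rw [← map_smul]
    congr 1
    funext i
    exact Subtype.ext (congrFun hvz i)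
  obtain ⟨r, hr0, hr, hvx | hvy⟩ := exists_pow_eq_self_smul_of_mul_eq hLL (fun i => (v i).2)
    (fun i => (w i).2) (fun i => (x i).2) (fun i => (y i).2) (hne hv) (hne hx) (hne hy)
    hmul hdiag hpow
  · obtain ⟨h₁, h₂⟩ := hspan hx h (fun h => hr0 (congrArg Subtype.val h)) (hsmul hr hvx)
    rw [h₁, h₂]
  · obtain ⟨h₁, h₂⟩ := hspan hy (h.trans (mul_comm _ _)) (fun h => hr0 (congrArg Subtype.val h))
      (hsmul hr hvy)
    rw [h₁, h₂, Set.pair_comm]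

end TwistedMap

end Sidon

theorem finrank_extendScalars_of_natCard {K : Type*} [Field K] {F L : Subfield K} [Finite L]
    (h : F ≤ L) {m : ℕ} (hF : 1 < Nat.card F) (hL : Nat.card L = Nat.card F ^ m) :
    Module.finrank F (Subfield.extendScalars h) = m := by
  have : Finite (Subfield.extendScalars h) := ‹Finite L›
  apply Nat.pow_right_injective hF
  simp only
  rw [← Module.natCard_eq_pow_finrank, ← hL]
  rfl

/-- For `kls ∣ n` with `k, l, s` pairwise coprime and `γ` a root of an
irreducible polynomial of degree `n/(kls) > 12` over `F_{q^{kls}}`, the indicated set is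
a Sidon space of dimension `k + l + s`. -/
theorem sidonSpace_sum_three_nontrivial_12 {K : Type*} [Field K] (q n k l s : ℕ)
    (hq : IsPrimePow q) (hn : 0 < n) (hk : 0 < k) (hl : 0 < l) (hs : 0 < s)
    (hkl : Nat.Coprime k l) (hks : Nat.Coprime k s) (hls : Nat.Coprime l s)
    (hkls : k * l * s ∣ n)
    (hK : Nat.card K = q ^ n)
    (F : Subfield K) (hF : Nat.card F = q)
    (Fk : Subfield K) (hFk : Nat.card Fk = q ^ k) (hFFk : F ≤ Fk)
    (Fl : Subfield K) (hFl : Nat.card Fl = q ^ l) (hFFl : F ≤ Fl)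
    (Fs : Subfield K) (hFs : Nat.card Fs = q ^ s) (hFFs : F ≤ Fs)
    (Fkls : Subfield K) (hFkls : Nat.card Fkls = q ^ (k * l * s))
    (hFkFkls : Fk ≤ Fkls) (hFlFkls : Fl ≤ Fkls) (hFsFkls : Fs ≤ Fkls)
    (γ : K) (hγ : γ ≠ 0)
    (hdeg : (minpoly Fkls γ).natDegree = n / (k * l * s)) (hdeg12 : 12 < n / (k * l * s))
    (δ₁ δ₂ : K) (hδ₁ : δ₁ ∈ Fl) (hδ₂ : δ₂ ∈ Fl) (hδ₁0 : δ₁ ≠ 0) (hδ₂0 : δ₂ ≠ 0)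
    (τ₁ τ₂ : K) (hτ₁ : τ₁ ∈ Fk) (hτ₂ : τ₂ ∈ Fk) (hτ₁0 : τ₁ ≠ 0) (hτ₂0 : τ₂ ≠ 0)
    (η₁ η₂ : K) (hη₁ : η₁ ∈ Fs) (hη₂ : η₂ ∈ Fs) (hη₁0 : η₁ ≠ 0) (hη₂0 : η₂ ≠ 0) :
    IsSidonSpace F
        (Submodule.span F
          {x : K | ∃ a ∈ Fl, ∃ u ∈ Fk, ∃ e ∈ Fs,
            x = δ₁ * a + δ₂ * a ^ q * γ + τ₁ * u * γ ^ 2 + τ₂ * u ^ q * γ ^ 3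
              + η₁ * e * γ ^ 5 + η₂ * e ^ q * γ ^ 6}) ∧
      Module.finrank F
        ↥(Submodule.span F
          {x : K | ∃ a ∈ Fl, ∃ u ∈ Fk, ∃ e ∈ Fs,
            x = δ₁ * a + δ₂ * a ^ q * γ + τ₁ * u * γ ^ 2 + τ₂ * u ^ q * γ ^ 3
              + η₁ * e * γ ^ 5 + η₂ * e ^ q * γ ^ 6}) = k + l + s := by
  subst hF
  have hq1 : 1 < Nat.card F := hq.one_lt
  have hq0 : Nat.card F ≠ 0 := by lia
  have hfin (L : Subfield K) {m : ℕ} (h : Nat.card L = Nat.card F ^ m) : Finite L :=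
    Nat.finite_of_card_ne_zero (h ▸ pow_ne_zero m hq0)
  have : Finite F := Nat.finite_of_card_ne_zero hq0
  have := hfin Fk hFk
  have := hfin Fl hFl
  have := hfin Fs hFs
  have hinter {m m' : ℕ} (A B : Subfield K) [Finite A] [Finite B] (hA : Nat.card A = Nat.card F ^ m)
      (hB : Nat.card B = Nat.card F ^ m') (hm : m.Coprime m') (x : K) (hxA : x ∈ A) (hxB : x ∈ B) :
      x ^ Nat.card F = x :=
    pow_eq_self_of_coprime hm (hA ▸ pow_natCard_eq_self hxA) (hB ▸ pow_natCard_eq_self hxB)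
  have hadd := add_pow_natCard_subfield F
  have hFpow : ∀ c ∈ F, c ^ Nat.card F = c := fun c hc => pow_natCard_eq_self hc
  have hL : ∀ i, F ≤ (![Fl, Fk, Fs] : Fin 3 → Subfield K) i := by
    simp [Fin.forall_fin_succ, hFFl, hFFk, hFFs]
  have hM : ∀ i, (![Fl, Fk, Fs] : Fin 3 → Subfield K) i ≤ Fkls := by
    simp [Fin.forall_fin_succ, hFlFkls, hFkFkls, hFsFkls]
  have hLL : ∀ i j, i ≠ j → ∀ x ∈ (![Fl, Fk, Fs] : Fin 3 → Subfield K) i,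
      x ∈ (![Fl, Fk, Fs] : Fin 3 → Subfield K) j → x ^ Nat.card F = x := by
    intro i j hij
    fin_cases i <;> fin_cases j <;> try exact absurd rfl hij
    exacts [hinter Fl Fk hFl hFk hkl.symm, hinter Fl Fs hFl hFs hls, hinter Fk Fl hFk hFl hkl,
      hinter Fk Fs hFk hFs hks, hinter Fs Fl hFs hFl hls.symm, hinter Fs Fk hFs hFk hks.symm]
  have hα : ∀ i, (![δ₁, τ₁, η₁] : Fin 3 → K) i ≠ 0 := by
    simp [Fin.forall_fin_succ, hδ₁0, hτ₁0, hη₁0]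
  have hβ : ∀ i, (![δ₂, τ₂, η₂] : Fin 3 → K) i ≠ 0 := by
    simp [Fin.forall_fin_succ, hδ₂0, hτ₂0, hη₂0]
  have hαM : ∀ i, (![δ₁, τ₁, η₁] : Fin 3 → K) i ∈ Fkls := by
    simp [Fin.forall_fin_succ, hFlFkls hδ₁, hFkFkls hτ₁, hFsFkls hη₁]
  have hβM : ∀ i, (![δ₂, τ₂, η₂] : Fin 3 → K) i ∈ Fkls := by
    simp [Fin.forall_fin_succ, hFlFkls hδ₂, hFkFkls hτ₂, hFsFkls hη₂]
  have hγ12 := hdeg ▸ hdeg12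
  set φ := twistedMap F hadd hFpow hL ![δ₁, τ₁, η₁] ![δ₂, τ₂, η₂] γ
  have hset : {x : K | ∃ a ∈ Fl, ∃ u ∈ Fk, ∃ e ∈ Fs,
      x = δ₁ * a + δ₂ * a ^ Nat.card F * γ + τ₁ * u * γ ^ 2 + τ₂ * u ^ Nat.card F * γ ^ 3
        + η₁ * e * γ ^ 5 + η₂ * e ^ Nat.card F * γ ^ 6} = LinearMap.range φ := by
    ext x
    constructor
    · rintro ⟨a, ha, u, hu, e, he, rfl⟩
      refine ⟨fun i => ⟨![a, u, e] i, ?_⟩, rfl⟩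
      fin_cases i
      exacts [ha, hu, he]
    · rintro ⟨v, rfl⟩
      exact ⟨v 0, (v 0).2, v 1, (v 1).2, v 2, (v 2).2, rfl⟩
  rw [hset, span_eq]
  refine ⟨isSidonSpace_range_twistedMap hadd hFpow hL hq0 (fun c => mem_of_pow_natCard_eq_self)
    hLL hα hβ hM hαM hβM hγ12, ?_⟩
  have hfinL (i) : Finite ((![Fl, Fk, Fs] : Fin 3 → Subfield K) i) := by
    fin_cases i <;> assumption
  have hfinE (i) : Module.Finite F (Subfield.extendScalars (hL i)) :=
    have : Finite (Subfield.extendScalars (hL i)) := hfinL i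
    inferInstance
  rw [LinearMap.finrank_range_of_inj
    (twistedMap_injective hadd hFpow hL hq0 hα hβ hM hαM hβM hγ12), Module.finrank_pi_fintype,
    Fin.sum_univ_three]
  have h₀ := finrank_extendScalars_of_natCard hFFl hq1 hFl
  have h₁ := finrank_extendScalars_of_natCard hFFk hq1 hFk
  have h₂ := finrank_extendScalars_of_natCard hFFs hq1 hFs
  calc _ = l + k + s := congrArg₂ _ (congrArg₂ _ h₀ h₁) h₂
    _ = k + l + s := by ring
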